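/- There exists a ring R whose group of units is cyclic of prime power order p^n (n ≥ 1) if and only if p^n = 8, or p^n = q - 1 for some Fermat prime q, or p^n = p with p a Mersenne prime. -/

import Mathlib

open Polynomial

/-- Units lift along quotients of finite commutative rings by maximal ideals. -/
lemma exists_unit_sub_mem {S : Type*} [CommRing S] [Finite S] (I : Ideal S) (hI : I.IsPrime)
    (x : S) (hx : x ∉ I) : ∃ y : Sˣ, (y : S) - x ∈ I := by
  obtain ⟨a, b, hab, h⟩ := Finite.exists_ne_map_eq_of_infinite (fun k : ℕ => x ^ (k + 1))
  wlog hlt : a < b generalizing a b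
  · exact this b a hab.symm h.symm (by omega)
  obtain ⟨c, rfl⟩ : ∃ c, b = a + (c + 1) := ⟨b - a - 1, by omega⟩
  have hper : ∀ i k, x ^ (a + 1 + i + (c + 1) * k) = x ^ (a + 1 + i) := by
    intro i k
    induction k with
    | zero => simp
    | succ k ih =>
      calc x ^ (a + 1 + i + (c + 1) * (k + 1))
          = x ^ (a + (c + 1) + 1) * x ^ (i + (c + 1) * k) := by rw [← pow_add]; congr 1; ring
        _ = x ^ (a + 1) * x ^ (i + (c + 1) * k) := by rw [← h]
        _ = x ^ (a + 1 + i + (c + 1) * k) := by rw [← pow_add]; congr 1; ring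
        _ = _ := ih
  set K := (c + 1) * (a + 1) with hK
  have hidem : x ^ K * x ^ K = x ^ K := by
    have := hper (c * (a + 1)) (a + 1)
    rw [← pow_add]
    convert this using 2 <;> rw [hK] <;> ring
  obtain ⟨j, hj⟩ : ∃ j, K = j + 1 := ⟨K - 1, by have : 0 < K := by positivity
                                                omega⟩
  have hx1 : x ^ j * x = x ^ K := by rw [hj, pow_succ]
  have hunit : (x * x ^ K + (1 - x ^ K)) * (x ^ j * x ^ K + (1 - x ^ K)) = 1 := by
    linear_combination (x ^ K * x ^ K) * hx1 + (x ^ K + 2 - x - x ^ j) * hidem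
  refine ⟨⟨_, _, hunit, by rw [mul_comm]; exact hunit⟩, ?_⟩
  have hmem : 1 - x ^ K ∈ I := by
    have h0 : x ^ K * (1 - x ^ K) ∈ I := by
      rw [show x ^ K * (1 - x ^ K) = 0 by linear_combination -hidem]; exact I.zero_mem
    exact (hI.mem_or_mem h0).resolve_left fun h' => hx (hI.mem_of_pow_mem _ h')
  have : x * x ^ K + (1 - x ^ K) - x = (1 - x) * (1 - x ^ K) := by ring
  simp only [this]
  exact I.mul_mem_left _ hmem

/-- If the units of a finite commutative ring form a cyclic group of prime power order and its
subgroup of prime order survives in a residue field, then so does the whole group. -/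
lemma card_quotient_eq {S : Type*} [CommRing S] [Finite S] {p k : ℕ} [Fact p.Prime] (u : Sˣ)
    (hgen : ∀ v : Sˣ, v ∈ Subgroup.zpowers u) (hord : orderOf u = p ^ (k + 1))
    (I : Ideal S) (hI : I.IsPrime) (hu : ((u : S) ^ p ^ k - 1) ∉ I) :
    ∃ q r : ℕ, q.Prime ∧ q ^ r = p ^ (k + 1) + 1 := by
  have : I.IsMaximal := Ideal.isMaximal_of_isPrime I
  let _ := Ideal.Quotient.field I
  let ψ : Sˣ →* (S ⧸ I)ˣ := Units.map (Ideal.Quotient.mk I : S →* S ⧸ I)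
  have hsurj : Function.Surjective ψ := by
    intro v
    obtain ⟨x, hx⟩ := Ideal.Quotient.mk_surjective (v : S ⧸ I)
    have hxI : x ∉ I := fun h => v.ne_zero (by rw [← hx]; exact Ideal.Quotient.eq_zero_iff_mem.2 h)
    obtain ⟨y, hy⟩ := exists_unit_sub_mem I hI x hxI
    refine ⟨y, Units.ext ?_⟩
    rw [← hx]
    exact Ideal.Quotient.eq.2 hy
  have hψ : orderOf (ψ u) = p ^ (k + 1) := by
    apply orderOf_eq_prime_pow
    · intro h
      apply hu
      rw [← Ideal.Quotient.eq, map_pow, map_one]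
      simpa [ψ] using congrArg Units.val h
    · rw [← map_pow, ← hord, pow_orderOf_eq_one, map_one]
  have hcard : Nat.card (S ⧸ I)ˣ = p ^ (k + 1) := by
    rw [← hψ]
    refine (orderOf_eq_card_of_forall_mem_zpowers fun v => ?_).symm
    obtain ⟨w, rfl⟩ := hsurj v
    obtain ⟨i, rfl⟩ := hgen w
    exact ⟨i, by simp⟩
  have hfin : Finite (S ⧸ I) :=
    Finite.of_surjective _ (Ideal.Quotient.mk_surjective (I := I))
  have hK := Nat.card_eq_card_units_add_one (S ⧸ I)
  let _ := Fintype.ofFinite (S ⧸ I)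
  obtain ⟨q, -, r, hqp, hr⟩ := FiniteField.card' (S ⧸ I)
  exact ⟨q, r, hqp, by rw [← hr, ← Nat.card_eq_fintype_card, hK, hcard]⟩

/-- A commutative ring of positive characteristic generated by one root of unity is finite. -/
lemma finite_of_aeval_surjective {S : Type*} [CommRing S] (u : S)
    (hs : Function.Surjective (aeval u : ℤ[X] →ₐ[ℤ] S)) {m : ℕ} (hm : 0 < m) (hu : u ^ m = 1)
    {d : ℤ} (hd : d ≠ 0) (hd0 : (d : S) = 0) : Finite S := by
  have hint : IsIntegral ℤ u := IsIntegral.of_pow hm (by rw [hu]; exact isIntegral_one)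
  have hfg := hint.fg_adjoin_singleton
  have htop : Algebra.adjoin ℤ {u} = ⊤ := by
    rw [Algebra.adjoin_singleton_eq_range_aeval]
    exact AlgHom.range_eq_top _ |>.2 hs
  rw [htop, Algebra.top_toSubmodule] at hfg
  have : Module.Finite ℤ S := ⟨hfg⟩
  refine Module.finite_of_fg_torsion S fun {x} => ⟨⟨d, mem_nonZeroDivisors_of_ne_zero hd⟩, ?_⟩
  change d • x = 0
  rw [zsmul_eq_mul, hd0, zero_mul]

/-- Two integer polynomials that are coprime over `ℚ` generate an ideal containing a nonzero
integer. -/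
lemma exists_int_of_isCoprime_map {f g : ℤ[X]}
    (h : IsCoprime (f.map (Int.castRingHom ℚ)) (g.map (Int.castRingHom ℚ))) :
    ∃ (d : ℤ) (a b : ℤ[X]), d ≠ 0 ∧ a * f + b * g = C d := by
  obtain ⟨a, b, hab⟩ := h
  obtain ⟨m, hm, ha⟩ := IsLocalization.integerNormalization_spec (nonZeroDivisors ℤ) a
  obtain ⟨n, hn, hb⟩ := IsLocalization.integerNormalization_spec (nonZeroDivisors ℤ) b
  refine ⟨m * n, C n * IsLocalization.integerNormalization (nonZeroDivisors ℤ) a,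
    C m * IsLocalization.integerNormalization (nonZeroDivisors ℤ) b,
    mul_ne_zero (nonZeroDivisors.ne_zero hm) (nonZeroDivisors.ne_zero hn), ?_⟩
  apply Polynomial.map_injective (Int.castRingHom ℚ) Int.cast_injective
  have e : algebraMap ℤ ℚ = Int.castRingHom ℚ := rfl
  rw [e] at ha hb
  simp only [Polynomial.map_add, Polynomial.map_mul, ha, hb, Polynomial.map_C, zsmul_eq_mul]
  simp only [eq_intCast, map_mul, map_intCast]
  linear_combination ((m : ℚ[X]) * n) * hab

/-- An element of order two in a cyclic group of order `2 ^ (k + 1)` is the obvious one. -/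
lemma eq_one_or_eq_of_sq_eq_one {G : Type*} [Group G] {u : G} {k : ℕ}
    (hgen : ∀ v : G, v ∈ Subgroup.zpowers u) (hord : orderOf u = 2 ^ (k + 1)) (v : G)
    (hv : v ^ 2 = 1) : v = 1 ∨ v = u ^ 2 ^ k := by
  obtain ⟨j, rfl⟩ := hgen v
  simp only at hv ⊢
  rw [← zpow_natCast, ← zpow_mul, ← orderOf_dvd_iff_zpow_eq_one, hord] at hv
  obtain ⟨c, hc⟩ := hv
  have hj : j = 2 ^ k * c := by push_cast at hc; rw [pow_succ] at hc; linarith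
  have h1 : u ^ (2 ^ k * 2) = 1 := by rw [← pow_succ, ← hord, pow_orderOf_eq_one]
  rcases Int.even_or_odd' c with ⟨e, rfl | rfl⟩
  · left
    rw [hj, show (2 : ℤ) ^ k * (2 * e) = ((2 ^ k * 2 : ℕ) : ℤ) * e by push_cast; ring, zpow_mul,
      zpow_natCast, h1, one_zpow]
  · right
    rw [hj, show (2 : ℤ) ^ k * (2 * e + 1) = ((2 ^ k * 2 : ℕ) : ℤ) * e + (2 ^ k : ℕ) by
      push_cast; ring, zpow_add, zpow_mul, zpow_natCast, h1, one_zpow, one_mul, zpow_natCast]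

lemma isNilpotent_sub_one {S : Type*} [CommRing S] {u : S} {n : ℕ} (h2 : IsNilpotent (2 : S))
    (hu : u ^ 2 ^ n = 1) : IsNilpotent (u - 1) := by
  rw [nilpotent_iff_mem_prime] at h2 ⊢
  intro J hJ
  have h2J : ((2 : ℕ) : S ⧸ J) = 0 := by
    rw [← map_natCast (Ideal.Quotient.mk J), Ideal.Quotient.eq_zero_iff_mem]
    exact_mod_cast h2 J hJ
  have : CharP (S ⧸ J) 2 := CharTwo.of_one_ne_zero_of_two_eq_zero one_ne_zero (by simpa using h2J)
  have h := sub_pow_char_pow (R := S ⧸ J) (p := 2) (n := n) (Ideal.Quotient.mk J u) 1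
  rw [← map_pow, hu, map_one, one_pow, sub_self] at h
  have h' := eq_zero_of_pow_eq_zero h
  rwa [← map_one (Ideal.Quotient.mk J), ← map_sub, Ideal.Quotient.eq_zero_iff_mem] at h'

/-- If `2` and `u - 1` are nilpotent and `x ^ 2 + 2 * x = 0`, that is `(1 + x) ^ 2 = 1`, has at
most one nonzero solution, then `u` has order dividing four. -/
lemma pow_four_eq_one {S : Type*} [CommRing S] [Nontrivial S] (u : Sˣ) (z : S)
    (hz : ∀ x : S, x ^ 2 + 2 * x = 0 → x = 0 ∨ x = z)
    (h2 : IsNilpotent (2 : S)) (ht : IsNilpotent ((u : S) - 1)) : (u : S) ^ 4 = 1 := by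
  obtain ⟨h4, h2t⟩ : (4 : S) = 0 ∧ 2 * ((u : S) - 1) = 0 := by
    by_cases h20 : (2 : S) = 0
    · exact ⟨by linear_combination 2 * h20, by rw [h20, zero_mul]⟩
    have hz2 : z = -2 := by
      rcases hz (-2) (by ring) with h | h
      · exact absurd (neg_eq_zero.1 h) h20
      · exact h.symm
    have h4 : (4 : S) = 0 := by
      by_contra h4
      have hk := pow_nilpotencyClass h2
      have h3 : 3 ≤ nilpotencyClass (2 : S) := by
        by_contra hlt
        apply h4
        have := pow_eq_zero_of_le (show nilpotencyClass (2 : S) ≤ 2 by omega) hk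
        linear_combination this
      obtain ⟨m, hm⟩ : ∃ m, nilpotencyClass (2 : S) = m + 3 :=
        ⟨nilpotencyClass (2 : S) - 3, by omega⟩
      rw [hm] at hk
      have hne : (2 : S) ^ (m + 2) ≠ 0 := by
        have := pow_pred_nilpotencyClass h2
        rwa [hm] at this
      have hx : 2 * (2 : S) ^ (m + 2) = 0 := by rw [← pow_succ']; exact hk
      rcases hz (2 ^ (m + 2)) (by linear_combination (2 ^ (m + 1) + 1) * hx) with h | h
      · exact hne h
      · rw [h, hz2] at hx
        exact h4 (by linear_combination -hx)
    refine ⟨h4, ?_⟩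
    rcases hz (2 * (u - 1)) (by linear_combination ((u - 1 : S) ^ 2 + (u - 1)) * h4) with h | h
    · exact h
    · rw [hz2] at h
      have hu : (u : S) * 2 = 0 := by linear_combination h
      exact absurd ((Units.mul_right_eq_zero u).1 hu) h20
  set t : S := u - 1 with htdef
  have ht4 : t ^ 4 = 0 := by
    by_contra hne
    have hk := pow_nilpotencyClass ht
    have h3 : 5 ≤ nilpotencyClass t := by
      by_contra hlt
      exact hne (pow_eq_zero_of_le (show nilpotencyClass t ≤ 4 by omega) hk)
    obtain ⟨m, hm⟩ : ∃ m, nilpotencyClass t = m + 5 := ⟨nilpotencyClass t - 5, by omega⟩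
    rw [hm] at hk
    have hne : t ^ (m + 4) ≠ 0 := by
      have := pow_pred_nilpotencyClass ht
      rwa [hm] at this
    have hne' : t ^ (m + 3) ≠ 0 := fun h => hne (by rw [pow_succ, h, zero_mul])
    have e1 := (hz (t ^ (m + 4))
      (by linear_combination t ^ (m + 3) * hk + t ^ (m + 3) * h2t)).resolve_left hne
    have e2 := (hz (t ^ (m + 3))
      (by linear_combination t ^ (m + 1) * hk + t ^ (m + 2) * h2t)).resolve_left hne'
    apply hne
    calc t ^ (m + 4) = t ^ (m + 3) * t := pow_succ _ _
      _ = t ^ (m + 4) * t := by rw [e2, e1]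
      _ = t ^ (m + 5) := (pow_succ _ _).symm
      _ = 0 := hk
  have hu : (u : S) = 1 + t := by rw [htdef]; ring
  rw [hu]
  linear_combination ht4 + (2 + 3 * t + 2 * t ^ 2) * h2t

/-- If every unit is a power of `u`, where `u ^ 2 ^ (k + 3) = -1`, then the characteristic is
positive, because `1 + u + u ^ 2` is a unit. -/
lemma exists_int_eq_zero {S : Type*} [CommRing S] {k : ℕ} (u : Sˣ)
    (hgen : ∀ v : Sˣ, v ∈ Subgroup.zpowers u) (hord : orderOf u = 2 ^ (k + 4))
    (hu : (u : S) ^ 2 ^ (k + 3) = -1) : ∃ d : ℤ, d ≠ 0 ∧ (d : S) = 0 := by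
  set N := 2 ^ (k + 3) with hN
  have hN8 : 8 ≤ N := by
    rw [hN, pow_add]; have := Nat.one_le_two_pow (n := k); omega
  have hN2 : 2 ^ (k + 4) = N + N := by rw [hN, pow_succ 2 (k + 3)]; ring
  have hw : IsUnit (1 + (u : S) + (u : S) ^ 2) := by
    by_contra hnu
    obtain ⟨P, hP, hmem⟩ := exists_max_ideal_of_mem_nonunits hnu
    set x := Ideal.Quotient.mk P (u : S)
    have h1 : 1 + x + x ^ 2 = 0 := by
      simpa [x] using Ideal.Quotient.eq_zero_iff_mem.2 hmem
    have h3 : x ^ 3 = 1 := by linear_combination (x - 1) * h1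
    have hxN : x ^ N = -1 := by
      simpa [x] using congrArg (Ideal.Quotient.mk P) hu
    have hx2 : x ^ 2 ^ (k + 4) = 1 := by rw [hN2, pow_add, hxN]; ring
    have hx : x = 1 := by
      rw [← orderOf_eq_one_iff]
      exact Nat.eq_one_of_dvd_coprimes (a := 3) (b := 2 ^ (k + 4))
        (Nat.Coprime.pow_right _ (by norm_num))
        (orderOf_dvd_of_pow_eq_one h3) (orderOf_dvd_of_pow_eq_one hx2)
    rw [hx] at h1 hxN
    rw [one_pow] at hxN
    have h10 : (1 : S ⧸ P) = 0 := by linear_combination h1 - hxN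
    exact hP.ne_top (Ideal.eq_top_iff_one _ |>.2 (by
      rw [← Ideal.Quotient.eq_zero_iff_mem, map_one, h10]))
  obtain ⟨w, hw⟩ := hw
  have hfin : IsOfFinOrder u := orderOf_pos_iff.1 (by rw [hord]; positivity)
  obtain ⟨j, hj, hjw⟩ : ∃ j < N + N, u ^ j = w := by
    classical
    have := hfin.mem_zpowers_iff_mem_range_orderOf.1 (hgen w)
    simpa [hord, hN2] using this
  have hjw' : (u : S) ^ j = 1 + u + u ^ 2 := by
    rw [← hw, ← hjw, Units.val_pow_eq_pow_val]
  obtain ⟨g, hgdeg, hg0, hgu⟩ : ∃ g : ℤ[X], g.natDegree < N ∧ g ≠ 0 ∧ aeval (u : S) g = 0 := by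
    rcases lt_or_ge j N with h | h
    · refine ⟨1 + X + X ^ 2 - X ^ j, ?_, fun h0 => ?_, ?_⟩
      · have : (1 + X + X ^ 2 - X ^ j : ℤ[X]).natDegree ≤ max 2 j := by
          refine (natDegree_sub_le _ _).trans (max_le_max ?_ ?_)
          · compute_degree
          · exact natDegree_X_pow_le _
        omega
      · have := congrArg (eval 1) h0
        simp at this
      · simp [hjw']
    · obtain ⟨i, rfl⟩ := Nat.exists_eq_add_of_le h
      refine ⟨1 + X + X ^ 2 + X ^ i, ?_, fun h0 => ?_, ?_⟩
      · have : (1 + X + X ^ 2 + X ^ i : ℤ[X]).natDegree ≤ max 2 i := by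
          refine (natDegree_add_le _ _).trans (max_le_max ?_ ?_)
          · compute_degree
          · exact natDegree_X_pow_le _
        omega
      · have := congrArg (eval 1) h0
        simp at this
      · rw [pow_add, hu] at hjw'
        simp [← hjw']
  have hcyc : cyclotomic (2 ^ (k + 3 + 1)) ℚ = 1 + X ^ N := by
    rw [cyclotomic_prime_pow_eq_geom_sum Nat.prime_two]
    simp [Finset.sum_range_succ, hN]
  have hirr : Irreducible (1 + X ^ N : ℚ[X]) := by
    rw [← hcyc]; exact cyclotomic.irreducible_rat (by positivity)
  have hcop : IsCoprime ((1 + X ^ N : ℤ[X]).map (Int.castRingHom ℚ))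
      (g.map (Int.castRingHom ℚ)) := by
    have hmap : (1 + X ^ N : ℤ[X]).map (Int.castRingHom ℚ) = 1 + X ^ N := by simp
    rw [hmap, hirr.coprime_iff_not_dvd]
    intro hdvd
    have hle := natDegree_le_of_dvd hdvd
      ((Polynomial.map_ne_zero_iff (f := Int.castRingHom ℚ) Int.cast_injective).2 hg0)
    have hdeg : (1 + X ^ N : ℚ[X]).natDegree = N := by
      rw [add_comm]; exact natDegree_X_pow_add_C (r := (1 : ℚ))
    have := natDegree_map_le (f := Int.castRingHom ℚ) (p := g)
    omega
  obtain ⟨d, a, b, hd, hab⟩ := exists_int_of_isCoprime_map hcop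
  refine ⟨d, hd, ?_⟩
  have := congrArg (aeval (u : S)) hab
  simp only [map_add, map_mul, hgu, map_one, map_pow, aeval_X, hu, aeval_C] at this
  simpa using this.symm

/-- A finite cyclic group of units is already the group of units of a commutative ring generated
by one unit. -/
lemma exists_commRing_of_isCyclic_units {R : Type*} [Ring R] [IsCyclic Rˣ] {m : ℕ} (hm : m ≠ 0)
    (h : Nat.card Rˣ = m) :
    ∃ (S : Type) (_ : CommRing S) (u : Sˣ), (∀ v : Sˣ, v ∈ Subgroup.zpowers u) ∧
      orderOf u = m ∧ Function.Surjective (aeval (u : S) : ℤ[X] →ₐ[ℤ] S) := by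
  obtain ⟨g, hg⟩ := IsCyclic.exists_generator (α := Rˣ)
  have hord : orderOf g = m := by rw [orderOf_eq_card_of_forall_mem_zpowers hg, h]
  let f : ℤ[X] →+* R := (aeval (g : R) : ℤ[X] →ₐ[ℤ] R)
  have hfX : f X = g := aeval_X (g : R)
  have hX : (Ideal.Quotient.mk (RingHom.ker f) X) ^ m = 1 := by
    rw [← map_pow, ← map_one (Ideal.Quotient.mk (RingHom.ker f)), Ideal.Quotient.eq,
      RingHom.mem_ker, map_sub, map_pow, hfX, map_one, ← Units.val_pow_eq_pow_val, ← hord,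
      pow_orderOf_eq_one, Units.val_one, sub_self]
  let u : (ℤ[X] ⧸ RingHom.ker f)ˣ := Units.ofPowEqOne _ m hX hm
  let φ : (ℤ[X] ⧸ RingHom.ker f)ˣ →* Rˣ :=
    Units.map (f.kerLift : (ℤ[X] ⧸ RingHom.ker f) →* R)
  have hφ : Function.Injective φ := Units.map_injective (RingHom.kerLift_injective f)
  have hφu : φ u = g := Units.ext (by
    change f.kerLift (Ideal.Quotient.mk (RingHom.ker f) X) = g
    rw [← hfX]
    rfl)
  refine ⟨_, inferInstance, u, fun v => ?_, ?_, fun x => ?_⟩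
  · obtain ⟨i, hi⟩ := hg (φ v)
    exact ⟨i, hφ (by simpa [hφu] using hi)⟩
  · rw [← orderOf_injective φ hφ, hφu, hord]
  · obtain ⟨q, rfl⟩ := Ideal.Quotient.mk_surjective x
    refine ⟨q, ?_⟩
    have hext : ((aeval (u : ℤ[X] ⧸ RingHom.ker f) : ℤ[X] →ₐ[ℤ] _) : ℤ[X] →+* _) =
        Ideal.Quotient.mk (RingHom.ker f) :=
      Polynomial.ringHom_ext' (Subsingleton.elim _ _) (aeval_X _)
    exact DFunLike.congr_fun hext q

lemma exponent_le_one {p n : ℕ} (hp : 1 < p) (h : p ^ n ≤ p) : n ≤ 1 :=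
  (Nat.pow_le_pow_iff_right hp).1 (by simpa using h)

lemma exponent_eq_one_of_pow_add_one_eq_two_pow {p n m : ℕ} (hp : Odd p) (hp1 : 1 < p)
    (hn : 1 ≤ n) (h : 2 ^ m = p ^ n + 1) : n = 1 := by
  rcases Nat.even_or_odd' n with ⟨e, rfl | rfl⟩
  · exfalso
    obtain ⟨c, hc⟩ : Odd (p ^ e) := hp.pow
    have hbig : 1 < p ^ (2 * e) := Nat.one_lt_pow (by omega) hp1
    have hsq : p ^ (2 * e) = 4 * (c ^ 2 + c) + 1 := by
      rw [mul_comm, pow_mul, hc]; ring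
    rcases m with _ | _ | m
    · omega
    · omega
    · rw [pow_add] at h; omega
  · have hdvd : p + 1 ∣ 2 ^ m := by
      rw [h]
      simpa using Odd.nat_add_dvd_pow_add_pow p 1 (n := 2 * e + 1) ⟨e, rfl⟩
    obtain ⟨a, -, ha⟩ := (Nat.dvd_prime_pow Nat.prime_two).1 hdvd
    have hmod : p ^ 2 ≡ 1 [MOD 2 ^ (a + 1)] := by
      obtain ⟨c, rfl⟩ := hp
      refine ((Nat.modEq_iff_dvd' (by nlinarith)).2 ⟨c, ?_⟩).symm
      rw [pow_succ 2 a, ← ha]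
      exact Nat.sub_eq_of_eq_add (by ring)
    have hmod' : p ^ (2 * e + 1) ≡ p [MOD 2 ^ (a + 1)] := by
      have := (hmod.pow e).mul_right p
      rwa [← pow_mul, ← pow_succ, one_pow, one_mul] at this
    have hma : m ≤ a := by
      by_contra hlt
      have h1 := hmod'.add_right 1
      rw [← h, ha] at h1
      have h2 := (h1.dvd_iff dvd_rfl).1 (pow_dvd_pow 2 (by omega))
      have := (Nat.pow_dvd_pow_iff_le_right (by norm_num)).1 h2
      omega
    have := Nat.pow_le_pow_right (n := 2) (by norm_num) hma
    have := exponent_le_one hp1 (n := 2 * e + 1) (by omega)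
    omega

lemma exponent_eq_one_or_of_pow_eq_two_pow_add_one {q r n : ℕ} (hn : 1 ≤ n)
    (h : q ^ r = 2 ^ n + 1) : r = 1 ∨ 2 ^ n = 8 := by
  have hodd : Odd (q ^ r) := by
    rw [h]
    exact Even.add_one ((Nat.even_pow.2 ⟨even_two, by omega⟩))
  have hn2 : 1 < 2 ^ n := Nat.one_lt_pow (by omega) (by norm_num)
  rcases Nat.even_or_odd' r with ⟨e, rfl | rfl⟩
  · right
    rw [mul_comm, pow_mul] at h
    obtain ⟨s, hs⟩ : ∃ s, q ^ e = s + 1 := ⟨q ^ e - 1, by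
      have : q ^ e ≠ 0 := by intro h0; simp [h0] at h
      omega⟩
    rw [hs] at h
    have hmul : s * (s + 2) = 2 ^ n := by linarith [show (s + 1) ^ 2 = s * (s + 2) + 1 by ring]
    obtain ⟨b, -, hb⟩ := (Nat.dvd_prime_pow Nat.prime_two).1 (Dvd.intro _ hmul)
    obtain ⟨c, -, hc⟩ := (Nat.dvd_prime_pow Nat.prime_two).1 (Dvd.intro_left _ hmul)
    have hs0 : 0 < s := by rw [hb]; positivity
    have hs2 : s = 2 := by
      rcases b with _ | _ | b
      · rcases c with _ | _ | c
        · omega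
        · omega
        · rw [pow_add] at hc; omega
      · omega
      · rcases c with _ | _ | c
        · omega
        · omega
        · simp only [pow_succ] at hb hc; omega
    rw [← hmul, hs2]
  · left
    have hq : Odd q := Nat.Odd.of_mul_right (m := q ^ (2 * e)) (by rwa [← pow_succ])
    have hq1 : 1 < q := by
      by_contra hlt
      obtain rfl | rfl : q = 0 ∨ q = 1 := by omega
      · simp at h
      · simp at h
    obtain ⟨t, rfl⟩ : ∃ t, q = t + 1 := ⟨q - 1, by omega⟩
    have hdvd : t ∣ 2 ^ n := by
      have := Nat.sub_dvd_pow_sub_pow (t + 1) 1 (2 * e + 1)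
      simpa [h] using this
    obtain ⟨a, -, ha⟩ := (Nat.dvd_prime_pow Nat.prime_two).1 hdvd
    have hmod : (t + 1) ^ 2 ≡ 1 [MOD 2 ^ (a + 1)] := by
      obtain ⟨c, hc⟩ := hq
      refine ((Nat.modEq_iff_dvd' (by nlinarith)).2 ⟨c + 1, ?_⟩).symm
      rw [pow_succ 2 a, ← ha]
      obtain rfl : t = 2 * c := by omega
      exact Nat.sub_eq_of_eq_add (by ring)
    have hmod' : (t + 1) ^ (2 * e + 1) ≡ t + 1 [MOD 2 ^ (a + 1)] := by
      have := (hmod.pow e).mul_right (t + 1)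
      rwa [← pow_mul, ← pow_succ, one_pow, one_mul] at this
    have hma : n ≤ a := by
      by_contra hlt
      rw [h] at hmod'
      have h1 := Nat.ModEq.add_right_cancel' 1 hmod'
      rw [ha] at h1
      have h2 := (h1.dvd_iff dvd_rfl).1 (pow_dvd_pow 2 (by omega))
      have := (Nat.pow_dvd_pow_iff_le_right (by norm_num)).1 h2
      omega
    have := Nat.pow_le_pow_right (n := 2) (by norm_num) hma
    have := exponent_le_one hq1 (n := 2 * e + 1) (by omega)
    omega

lemma exists_two_pow_of_odd {S : Type*} [CommRing S] {p k : ℕ} [Fact p.Prime] (hp : Odd p)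
    (u : Sˣ) (hgen : ∀ v : Sˣ, v ∈ Subgroup.zpowers u) (hord : orderOf u = p ^ (k + 1))
    (hs : Function.Surjective (aeval (u : S) : ℤ[X] →ₐ[ℤ] S)) :
    ∃ r : ℕ, 2 ^ r = p ^ (k + 1) + 1 := by
  have hsq : ∀ v : Sˣ, v ^ 2 = 1 → v = 1 := by
    intro v hv
    rw [← orderOf_eq_one_iff]
    have hcard : orderOf v ∣ p ^ (k + 1) := by
      rw [← hord, orderOf_eq_card_of_forall_mem_zpowers hgen]
      exact orderOf_dvd_natCard v
    exact Nat.eq_one_of_dvd_coprimes (a := 2) (b := p ^ (k + 1))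
      (Nat.Coprime.pow_right _ (Nat.coprime_two_left.2 hp)) (orderOf_dvd_of_pow_eq_one hv) hcard
  have h2 : (2 : S) = 0 := by
    have := congrArg Units.val (hsq (-1) (by simp))
    rw [Units.val_neg, Units.val_one] at this
    linear_combination -this
  have hred : ∀ x : S, x ^ 2 = 0 → x = 0 := by
    intro x hx
    have h1 : (1 + x) * (1 + x) = 1 := by linear_combination hx + x * h2
    have := congrArg Units.val (hsq ⟨_, _, h1, h1⟩ (Units.ext (by simpa [pow_two] using h1)))
    simpa using this
  have : IsReduced S := isReduced_iff_pow_one_lt 2 (by norm_num) |>.2 hred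
  have hfin : Finite S := finite_of_aeval_surjective (u : S) hs
    (m := p ^ (k + 1)) (pow_pos (Fact.out : p.Prime).pos _)
    (by rw [← Units.val_pow_eq_pow_val, ← hord, pow_orderOf_eq_one, Units.val_one])
    (d := 2) (by norm_num) (by exact_mod_cast h2)
  have hne : ¬ IsNilpotent ((u : S) ^ p ^ k - 1) := by
    rw [isNilpotent_iff_eq_zero, sub_eq_zero, ← Units.val_pow_eq_pow_val, Units.val_eq_one,
      ← orderOf_dvd_iff_pow_eq_one, hord,
      Nat.pow_dvd_pow_iff_le_right (Fact.out : p.Prime).one_lt]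
    omega
  rw [nilpotent_iff_mem_prime] at hne
  push Not at hne
  obtain ⟨I, hI, hu⟩ := hne
  obtain ⟨q, r, hq, hqr⟩ := card_quotient_eq u hgen hord I hI hu
  have heven : Even (q ^ r) := by rw [hqr]; exact hp.pow.add_one
  have hq2 : q = 2 := (hq.even_iff).1 (Nat.even_pow.1 heven).1
  exact ⟨r, by rw [← hqr, hq2]⟩

lemma exists_prime_pow_of_two {S : Type*} [CommRing S] {k : ℕ}
    (u : Sˣ) (hgen : ∀ v : Sˣ, v ∈ Subgroup.zpowers u) (hord : orderOf u = 2 ^ (k + 4))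
    (hs : Function.Surjective (aeval (u : S) : ℤ[X] →ₐ[ℤ] S)) :
    ∃ q r : ℕ, q.Prime ∧ q ^ r = 2 ^ (k + 4) + 1 := by
  have hu1 : (u : S) ^ 2 ^ (k + 4) = 1 := by
    rw [← Units.val_pow_eq_pow_val, ← hord, pow_orderOf_eq_one, Units.val_one]
  have hnil : ¬ IsNilpotent (2 : S) := by
    intro h2
    have hS : Nontrivial S := by
      by_contra hS
      rw [not_nontrivial_iff_subsingleton] at hS
      have : orderOf u = 1 := by rw [orderOf_eq_one_iff]; exact Subsingleton.elim _ _
      rw [hord] at this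
      exact absurd this (Nat.one_lt_pow (by omega) (by norm_num)).ne'
    have h4 := pow_four_eq_one u ((u : S) ^ 2 ^ (k + 3) - 1) (fun x hx => by
      have h1 : (1 + x) * (1 + x) = 1 := by linear_combination hx
      rcases eq_one_or_eq_of_sq_eq_one hgen hord ⟨_, _, h1, h1⟩
        (Units.ext (by simpa [pow_two] using h1)) with h | h
      · left
        simpa using congrArg Units.val h
      · right
        have h' : 1 + x = (u : S) ^ 2 ^ (k + 3) := by simpa using congrArg Units.val h
        linear_combination h') h2 (isNilpotent_sub_one h2 hu1)
    have h4' : u ^ 4 = 1 := Units.ext (by simpa using h4)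
    have hdvd := orderOf_dvd_of_pow_eq_one h4'
    rw [hord, show 4 = 2 ^ 2 by norm_num, Nat.pow_dvd_pow_iff_le_right (by norm_num)] at hdvd
    omega
  have hneg : (u : S) ^ 2 ^ (k + 3) = -1 := by
    rcases eq_one_or_eq_of_sq_eq_one hgen hord (-1) (by simp) with h | h
    · have h' := congrArg Units.val h
      rw [Units.val_neg, Units.val_one] at h'
      have h20 : (2 : S) = 0 := by linear_combination -h'
      exact absurd (h20 ▸ IsNilpotent.zero) hnil
    · simpa using (congrArg Units.val h).symm
  obtain ⟨d, hd, hd0⟩ := exists_int_eq_zero u hgen hord hneg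
  have hfin : Finite S := finite_of_aeval_surjective (u : S) hs (by positivity) hu1 hd hd0
  rw [nilpotent_iff_mem_prime] at hnil
  push Not at hnil
  obtain ⟨I, hI, h2⟩ := hnil
  obtain ⟨q, r, hq, hqr⟩ := card_quotient_eq (k := k + 3) u hgen hord I hI (fun h => h2 (by
    rw [hneg] at h
    rw [show (2 : S) = -(-1 - 1) by ring]
    exact I.neg_mem h))
  exact ⟨q, r, hq, hqr⟩

lemma exists_ring_of_field_card {m : ℕ} (K : Type) [Field K] [Finite K]
    (h : Nat.card K = m + 1) : ∃ (R : Type) (_ : Ring R), IsCyclic Rˣ ∧ Nat.card Rˣ = m :=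
  ⟨K, inferInstance, inferInstance, by rw [Nat.card_units, h, Nat.add_sub_cancel]⟩

theorem fuchs_stmt19 (p n : ℕ) (hp : p.Prime) (hn : 1 ≤ n) :
    (∃ (R : Type) (_ : Ring R), IsCyclic Rˣ ∧ Nat.card Rˣ = p ^ n) ↔
      (p ^ n = 8 ∨
       (∃ q : ℕ, q.Prime ∧ (∃ k : ℕ, 1 ≤ k ∧ q = 2 ^ k + 1) ∧ p ^ n = q - 1) ∨
       (p ^ n = p ∧ ∃ m : ℕ, 1 ≤ m ∧ p = 2 ^ m - 1)) := by
  have : Fact p.Prime := ⟨hp⟩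
  constructor
  · rintro ⟨R, _, hcyc, hcard⟩
    obtain ⟨S, _, u, hgen, hord, hs⟩ :=
      exists_commRing_of_isCyclic_units (pow_ne_zero n hp.ne_zero) hcard
    rcases hp.eq_two_or_odd' with rfl | hodd
    · rcases Nat.lt_or_ge n 4 with h4 | h4
      · interval_cases n
        · exact Or.inr (Or.inl ⟨3, by norm_num, ⟨1, by norm_num⟩, by norm_num⟩)
        · exact Or.inr (Or.inl ⟨5, by norm_num, ⟨2, by norm_num⟩, by norm_num⟩)
        · exact Or.inl (by norm_num)
      · obtain ⟨k, rfl⟩ := Nat.exists_eq_add_of_le' h4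
        obtain ⟨q, r, hq, hqr⟩ := exists_prime_pow_of_two u hgen hord hs
        rcases exponent_eq_one_or_of_pow_eq_two_pow_add_one hn hqr with rfl | h8
        · rw [pow_one] at hqr
          exact Or.inr (Or.inl ⟨q, hq, ⟨k + 4, hn, hqr⟩, by omega⟩)
        · exact Or.inl h8
    · obtain ⟨k, rfl⟩ := Nat.exists_eq_add_of_le' hn
      obtain ⟨r, hr⟩ := exists_two_pow_of_odd hodd u hgen hord hs
      have h1 := exponent_eq_one_of_pow_add_one_eq_two_pow hodd hp.one_lt hn hr
      rw [h1, pow_one] at hr ⊢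
      refine Or.inr (Or.inr ⟨rfl, r, ?_, by omega⟩)
      by_contra h0
      obtain rfl : r = 0 := by omega
      have := hp.pos
      omega
  · rintro (h | ⟨q, hq, -, h⟩ | ⟨h, m, hm, hpm⟩)
    · rw [h]
      have : Fact (Nat.Prime 3) := ⟨Nat.prime_three⟩
      exact exists_ring_of_field_card (GaloisField 3 2) (by
        rw [GaloisField.card 3 2 (by norm_num)]; norm_num)
    · have : Fact q.Prime := ⟨hq⟩
      refine exists_ring_of_field_card (ZMod q) ?_
      rw [Nat.card_zmod, h]
      have := hq.pos
      omega
    · rw [h]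
      refine exists_ring_of_field_card (GaloisField 2 m) ?_
      rw [GaloisField.card 2 m (by omega)]
      have := Nat.one_le_two_pow (n := m)
      omega
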